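/- Let 𝔽 be ℝ or ℂ and let n, p be positive integers with p even. Then max.rank_𝔽(n,n,p) ≤ n(p+2)/2 − 1. -/

import Mathlib

/-- The rank of a 3-tensor, presented as a family of matrices (its slices):
the least `r` such that each slice `A k` is `∑ i, (c i k) • (a i) (b i)ᵀ`
for some vectors `a i`, `b i`, `c i`. -/
noncomputable def tensorRank (𝔽 : Type*) [Field 𝔽] {α β γ : Type*}
    [Fintype α] [Fintype β] [Fintype γ] (A : γ → Matrix α β 𝔽) : ℕ :=
  sInf {r : ℕ | ∃ (a : Fin r → α → 𝔽) (b : Fin r → β → 𝔽) (c : Fin r → γ → 𝔽),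
    ∀ k, A k = ∑ i, c i k • Matrix.vecMulVec (a i) (b i)}

/-- `maxRank 𝔽 m n p` is the maximal rank of an `m × n × p` tensor over `𝔽`. -/
noncomputable def maxRank (𝔽 : Type*) [Field 𝔽] (m n p : ℕ) : ℕ :=
  sSup {r : ℕ | ∃ A : Fin p → Matrix (Fin m) (Fin n) 𝔽, tensorRank 𝔽 A = r}

open Filter Topology Matrix in
/-- Near a pair of diagonal matrices whose columns of diagonal entries are pairwise independent,
every pair of matrices is simultaneously diagonalizable by a left and a right factor. -/
lemma eventually_exists_eq_mul_diagonal_mul {𝔽 ι : Type*} [RCLike 𝔽] [Fintype ι] [DecidableEq ι]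
    (c : Fin 2 → ι → 𝔽) (hc : ∀ i j, i ≠ j → c 0 i * c 1 j ≠ c 0 j * c 1 i) :
    ∀ᶠ M : Fin 2 → Matrix ι ι 𝔽 in 𝓝 (fun q => diagonal (c q)),
      ∃ (U V : Matrix ι ι 𝔽) (d : Fin 2 → ι → 𝔽), ∀ q, M q = U * diagonal (d q) * V := by
  let f : (ι → ι → 𝔽) × (ι → ι → 𝔽) × (Fin 2 → ι → 𝔽) → Fin 2 → ι → ι → 𝔽 :=
    fun x q i j => ∑ k, x.1 i k * x.2.2 q k * x.2.1 k j
  let x₀ : (ι → ι → 𝔽) × (ι → ι → 𝔽) × (Fin 2 → ι → 𝔽) :=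
    ((1 : Matrix ι ι 𝔽), (1 : Matrix ι ι 𝔽), c)
  have hdiff : ContDiff 𝔽 1 f := by
    refine contDiff_pi.2 fun q => contDiff_pi.2 fun i => contDiff_pi.2 fun j => ?_
    fun_prop
  have hstrict : HasStrictFDerivAt f (fderiv 𝔽 f x₀) x₀ :=
    hdiff.contDiffAt.hasStrictFDerivAt one_ne_zero
  have hderiv (y : (ι → ι → 𝔽) × (ι → ι → 𝔽) × (Fin 2 → ι → 𝔽)) (q : Fin 2) (i j : ι) :
      fderiv 𝔽 f x₀ y q i j =
        y.1 i j * c q j + (if i = j then y.2.2 q i else 0) + c q i * y.2.1 i j := by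
    have hline : HasDerivAt (fun t : 𝔽 => f (x₀ + t • y)) (fderiv 𝔽 f x₀ y) 0 :=
      hstrict.hasFDerivAt.hasLineDerivAt y
    have hline' := hasDerivAt_pi.1 (hasDerivAt_pi.1 (hasDerivAt_pi.1 hline q) i) j
    refine hline'.unique ?_
    have haff (a b : 𝔽) : HasDerivAt (fun t : 𝔽 => a + t * b) b 0 := by
      simpa using ((hasDerivAt_id (0 : 𝔽)).mul_const b).const_add a
    have hsum := HasDerivAt.fun_sum (u := Finset.univ) fun k (_ : k ∈ Finset.univ) =>
      (((haff ((1 : Matrix ι ι 𝔽) i k) (y.1 i k)).fun_mul (haff (c q k) (y.2.2 q k))).fun_mul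
        (haff ((1 : Matrix ι ι 𝔽) k j) (y.2.1 k j)))
    convert! hsum using 1
    by_cases h : i = j <;> simp [Matrix.one_apply, Finset.sum_add_distrib, ite_mul, h]
  have hsurj : (fderiv 𝔽 f x₀).range = ⊤ := by
    refine LinearMap.range_eq_top.2 fun T => ?_
    refine ⟨(fun i j => if i = j then 0 else
        (T 0 i j * c 1 i - T 1 i j * c 0 i) / (c 0 j * c 1 i - c 0 i * c 1 j),
      fun i j => if i = j then 0 else
        (T 1 i j * c 0 j - T 0 i j * c 1 j) / (c 0 j * c 1 i - c 0 i * c 1 j),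
      fun q i => T q i i), ?_⟩
    ext q i j
    refine (hderiv _ q i j).trans ?_
    by_cases h : i = j
    · subst h; simp
    · have hne : c 0 j * c 1 i - c 0 i * c 1 j ≠ 0 := sub_ne_zero.2 (hc i j h).symm
      simp only [if_neg h]
      rw [add_zero, div_mul_eq_mul_div, mul_div_assoc', ← add_div, div_eq_iff hne]
      fin_cases q <;> simp <;> ring
  have hmap := hstrict.map_nhds_eq_of_surj hsurj
  have hx₀ : f x₀ = fun q => diagonal (c q) := by
    ext q i j
    by_cases h : i = j <;> simp [f, x₀, Matrix.one_apply, h]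
  rw [hx₀] at hmap
  have hrange : Set.range f ∈ 𝓝 (fun q => diagonal (c q) : Fin 2 → ι → ι → 𝔽) :=
    hmap ▸ range_mem_map
  refine mem_of_superset hrange ?_
  rintro _ ⟨x, rfl⟩
  refine ⟨of x.1, of x.2.1, x.2.2, fun q => ?_⟩
  ext i j
  rw [Matrix.mul_apply]
  simp only [Matrix.mul_diagonal, of_apply]
  rfl

/-- A nonzero vector of `𝔽²` can be completed to a family of pairwise independent vectors. -/
lemma exists_pairwise_independent {𝔽 ι : Type*} [Field 𝔽] [Infinite 𝔽] [Finite ι] [DecidableEq ι]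
    (l : ι) (a b : 𝔽) (hab : a ≠ 0 ∨ b ≠ 0) :
    ∃ c : Fin 2 → ι → 𝔽, c 0 l = a ∧ c 1 l = b ∧
      ∀ i j, i ≠ j → c 0 i * c 1 j ≠ c 0 j * c 1 i := by
  have hinf : {x : 𝔽 | a * x ≠ b}.Infinite := by
    have hfin : {x : 𝔽 | a * x = b}.Finite := by
      refine Set.Subsingleton.finite fun x hx y hy => ?_
      have ha : a ≠ 0 := by
        rintro rfl
        simp_all
      exact mul_left_cancel₀ ha (Eq.trans hx (Eq.symm hy))
    exact hfin.infinite_compl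
  have := hinf.to_subtype
  obtain ⟨d⟩ : Nonempty (ι ↪ {x : 𝔽 | a * x ≠ b}) := by
    have := Fintype.ofFinite ι
    exact ⟨(Fintype.equivFin ι).toEmbedding.trans
      (Fin.valEmbedding.trans (Infinite.natEmbedding _))⟩
  refine ⟨![fun i => if i = l then a else 1, fun i => if i = l then b else d i], by simp, by simp,
    fun i j hij => ?_⟩
  have hi := (d i).2
  have hj := (d j).2
  have hd : (d i : 𝔽) ≠ d j := fun h => hij (d.injective (Subtype.ext h))
  simp only [Set.mem_ofPred_eq] at hi hj
  by_cases h₁ : i = l <;> by_cases h₂ : j = l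
  · exact absurd (h₁.trans h₂.symm) hij
  · simpa [h₁, h₂] using hj
  · simpa [h₁, h₂] using hi.symm
  · simpa [h₁, h₂] using hd.symm

open Filter Topology Matrix in
/-- If the `(l, l)` entries of a pair of square matrices are not both zero, then the pair becomes
simultaneously diagonalizable (by a left and a right factor) after subtracting diagonal matrices
that vanish at `l`. -/
lemma exists_eq_diagonal_add_mul_diagonal_mul {𝔽 ι : Type*} [RCLike 𝔽] [Fintype ι] [DecidableEq ι]
    (A : Fin 2 → Matrix ι ι 𝔽) (l : ι) (hA : ∃ q, A q l l ≠ 0) :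
    ∃ (s : Fin 2 → ι → 𝔽) (U V : Matrix ι ι 𝔽) (d : Fin 2 → ι → 𝔽), (∀ q, s q l = 0) ∧
      ∀ q, A q = diagonal (s q) + U * diagonal (d q) * V := by
  obtain ⟨c, hc0, hc1, hc⟩ := exists_pairwise_independent l (A 0 l l) (A 1 l l)
    (by simpa [Fin.exists_fin_two] using hA)
  let w : 𝔽 → ι → 𝔽 := fun t i => if i = l then 1 else t
  let e : Fin 2 → ι → 𝔽 := fun q i => if i = l then 0 else c q i
  let M : 𝔽 → Fin 2 → Matrix ι ι 𝔽 := fun t q =>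
    diagonal (w t) * A q * diagonal (w t) + diagonal (e q)
  have hcont : Continuous M := by
    refine continuous_pi fun q => continuous_matrix fun i j => ?_
    have hw (i : ι) : Continuous fun t => w t i := by
      by_cases h : i = l
      · simpa [w, h] using continuous_const
      · simp only [w, if_neg h]
        exact continuous_id
    simp only [M, Matrix.add_apply, Matrix.mul_diagonal, Matrix.diagonal_mul]
    exact (((hw i).mul continuous_const).mul (hw j)).add continuous_const
  have hM0 : M 0 = fun q => diagonal (c q) := by
    have hcl (q : Fin 2) : A q l l = c q l := by fin_cases q <;> simp [hc0, hc1]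
    ext q i j
    rcases eq_or_ne i j with rfl | hij
    · by_cases hi : i = l
      · subst hi
        simp [M, w, e, hcl]
      · simp [M, w, e, hi]
    · have hw : w 0 i = 0 ∨ w 0 j = 0 := by
        by_cases hi : i = l
        · simp [w, show j ≠ l from fun hj => hij (hi.trans hj.symm)]
        · simp [w, hi]
      rcases hw with hw | hw <;> simp [M, hij, hw]
  have hev : ∀ᶠ t in 𝓝[≠] (0 : 𝔽), ∃ (U V : Matrix ι ι 𝔽) (d : Fin 2 → ι → 𝔽),
      ∀ q, M t q = U * diagonal (d q) * V :=
    (hcont.tendsto' 0 _ hM0).mono_left nhdsWithin_le_nhds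
      |>.eventually (eventually_exists_eq_mul_diagonal_mul c hc)
  obtain ⟨t, ⟨U, V, d, h⟩, ht⟩ := (hev.and self_mem_nhdsWithin).exists
  have ht : t ≠ 0 := ht
  have hw (i : ι) : w t i ≠ 0 := by
    by_cases hi : i = l <;> simp [w, hi, ht]
  refine ⟨fun q i => -((w t i)⁻¹ * e q i * (w t i)⁻¹), diagonal (w t)⁻¹ * U,
    V * diagonal (w t)⁻¹, d, fun q => by simp [e], fun q => ?_⟩
  have hassoc : diagonal (w t)⁻¹ * U * diagonal (d q) * (V * diagonal (w t)⁻¹) =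
      diagonal (w t)⁻¹ * M t q * diagonal (w t)⁻¹ := by
    rw [h q]; simp only [Matrix.mul_assoc]
  rw [hassoc]
  ext i j
  have hi := hw i
  have hj := hw j
  by_cases hij : i = j
  · subst hij
    simp [M]
    field_simp
    ring
  · simp [M, hij]
    field_simp

open Matrix in
/-- Finitely many nonzero square matrices acquire nonzero `(l, l)` entries simultaneously
after suitable changes of bases. -/
lemma exists_isUnit_mul_mul_apply_ne_zero {𝔽 ι κ : Type*} [Field 𝔽] [Infinite 𝔽] [Fintype ι]
    [DecidableEq ι] [Finite κ] (M : κ → Matrix ι ι 𝔽) (l : ι) :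
    ∃ P Q : Matrix ι ι 𝔽, IsUnit P ∧ IsUnit Q ∧ ∀ x, M x ≠ 0 → (P * M x * Q) l l ≠ 0 := by
  have key (w : {x // M x ≠ 0} → ι → 𝔽) (hw : ∀ x, w x ≠ 0) :
      ∃ u : ι → 𝔽, u l ≠ 0 ∧ ∀ x, w x ⬝ᵥ u ≠ 0 := by
    obtain ⟨u, hu⟩ := Module.Dual.exists_forall_ne_zero_of_forall_exists
      (fun x : Option {x // M x ≠ 0} =>
        dotProductBilin 𝔽 𝔽 (x.elim (Pi.single l (1 : 𝔽)) w)) (by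
      intro x
      have hx : x.elim (Pi.single l (1 : 𝔽)) w ≠ 0 := by
        cases x with
        | none => simp
        | some x => exact hw x
      by_contra! h
      exact hx (dotProduct_eq_zero _ h))
    exact ⟨u, by simpa using hu none, fun x => hu (some x)⟩
  have hrow (x : {x // M x ≠ 0}) : ∃ i, M x i ≠ 0 := by
    by_contra! h
    exact x.2 (funext h)
  choose i hi using hrow
  obtain ⟨v, hvl, hv⟩ := key (fun x => M x (i x)) hi
  obtain ⟨u, hul, hu⟩ := key (fun x => M x *ᵥ v) fun x h => hv x (congrFun h (i x))
  have hunit (u : ι → 𝔽) (hul : u l ≠ 0) : IsUnit ((1 : Matrix ι ι 𝔽).updateCol l u) := by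
    rw [Matrix.isUnit_iff_isUnit_det, ← cramer_apply, cramer_one]
    simpa using hul
  refine ⟨((1 : Matrix ι ι 𝔽).updateCol l u)ᵀ, (1 : Matrix ι ι 𝔽).updateCol l v,
    by rw [isUnit_transpose]; exact hunit u hul, hunit v hvl, fun x hx => ?_⟩
  convert! hu ⟨x, hx⟩ using 1
  rw [Matrix.mul_assoc]
  simp only [Matrix.mul_apply, transpose_apply, updateCol_self, dotProduct, mulVec]
  exact Finset.sum_congr rfl fun i _ => mul_comm _ _

open Matrix in
lemma Matrix.mul_diagonal_mul_eq_sum_vecMulVec {𝔽 ι κ : Type*} [CommRing 𝔽] [Fintype κ]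
    [DecidableEq κ] (U : Matrix ι κ 𝔽) (d : κ → 𝔽) (V : Matrix κ ι 𝔽) :
    U * diagonal d * V = ∑ k, d k • vecMulVec (Uᵀ k) (V k) := by
  ext i j
  rw [Matrix.mul_apply, Matrix.sum_apply]
  refine Finset.sum_congr rfl fun k _ => ?_
  simp [vecMulVec_apply]
  ring

lemma tensorRank_le_card {𝔽 α β γ κ : Type*} [Field 𝔽] [Fintype α] [Fintype β] [Fintype γ]
    [Fintype κ] {A : γ → Matrix α β 𝔽} (a : κ → α → 𝔽) (b : κ → β → 𝔽) (c : κ → γ → 𝔽)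
    (h : ∀ k, A k = ∑ i, c i k • Matrix.vecMulVec (a i) (b i)) :
    tensorRank 𝔽 A ≤ Fintype.card κ := by
  let e := (Fintype.equivFin κ).symm
  refine Nat.sInf_le ⟨a ∘ e, b ∘ e, c ∘ e, fun k => (h k).trans ?_⟩
  exact (e.sum_comp fun i => c i k • Matrix.vecMulVec (a i) (b i)).symm

open Matrix in
/-- A family of `h` pairs of `ι × ι` matrices has rank at most `(|ι| - 1) + h |ι|`. -/
lemma tensorRank_pairs_le {𝔽 ι γ κ : Type*} [RCLike 𝔽] [Fintype ι] [DecidableEq ι] [Fintype γ]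
    [Fintype κ] (e : γ ≃ κ × Fin 2) (A : γ → Matrix ι ι 𝔽) (l : ι) :
    tensorRank 𝔽 A ≤ Fintype.card ι - 1 + Fintype.card κ * Fintype.card ι := by
  obtain ⟨P, Q, hP, hQ, hPQ⟩ := exists_isUnit_mul_mul_apply_ne_zero A l
  have hpair (g : κ) : ∃ (s : Fin 2 → ι → 𝔽) (U V : Matrix ι ι 𝔽) (d : Fin 2 → ι → 𝔽),
      (∀ q, s q l = 0) ∧
      ∀ q, P * A (e.symm (g, q)) * Q = diagonal (s q) + U * diagonal (d q) * V := by
    by_cases hg : ∃ q, A (e.symm (g, q)) ≠ 0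
    · obtain ⟨q, hq⟩ := hg
      exact exists_eq_diagonal_add_mul_diagonal_mul _ l ⟨q, hPQ _ hq⟩
    · push Not at hg
      exact ⟨0, 0, 0, 0, by simp, by simp [hg]⟩
  choose s U V d hs h using hpair
  have hA (g : κ) (q : Fin 2) : A (e.symm (g, q)) =
      P⁻¹ * diagonal (s g q) * Q⁻¹ + (P⁻¹ * U g) * diagonal (d g q) * (V g * Q⁻¹) := by
    have hP' := (Matrix.isUnit_iff_isUnit_det P).1 hP
    have hQ' := (Matrix.isUnit_iff_isUnit_det Q).1 hQ
    calc A (e.symm (g, q)) = P⁻¹ * (P * A (e.symm (g, q)) * Q) * Q⁻¹ := by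
          rw [Matrix.mul_assoc P, Matrix.nonsing_inv_mul_cancel_left _ _ hP',
            Matrix.mul_nonsing_inv_cancel_right _ _ hQ']
      _ = _ := by rw [h]; simp only [Matrix.mul_add, Matrix.add_mul, Matrix.mul_assoc]
  have hcard : Fintype.card ({i // i ≠ l} ⊕ κ × ι) =
      Fintype.card ι - 1 + Fintype.card κ * Fintype.card ι := by
    rw [Fintype.card_sum, Fintype.card_prod, Fintype.card_subtype_compl, Fintype.card_subtype_eq]
  classical
  rw [← hcard]
  refine tensorRank_le_card
    (Sum.elim (fun i => (P⁻¹)ᵀ i) fun x => (P⁻¹ * U x.1)ᵀ x.2)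
    (Sum.elim (fun i => Q⁻¹ i) fun x => (V x.1 * Q⁻¹) x.2)
    (Sum.elim (fun i k => s (e k).1 (e k).2 i)
      fun x k => if x.1 = (e k).1 then d (e k).1 (e k).2 x.2 else 0) fun k => ?_
  obtain ⟨⟨g, q⟩, rfl⟩ := e.symm.surjective k
  rw [hA, Matrix.mul_diagonal_mul_eq_sum_vecMulVec, Matrix.mul_diagonal_mul_eq_sum_vecMulVec,
    Fintype.sum_sum_type, Fintype.sum_prod_type, Fintype.sum_eq_add_sum_subtype_ne _ l]
  simp [hs, ite_smul, Finset.sum_ite_irrel]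

/-- If `𝔽` is `ℝ` or `ℂ` and `p` is even, then
`maxRank 𝔽 n n p ≤ n * (p + 2) / 2 - 1`. -/
theorem stmt6 {𝔽 : Type*} [RCLike 𝔽] {n p : ℕ}
    (hn : 0 < n) (hp : 0 < p) (heven : Even p) :
    maxRank 𝔽 n n p ≤ n * (p + 2) / 2 - 1 := by
  obtain ⟨h, rfl⟩ := heven.two_dvd
  have hbound : n * (2 * h + 2) / 2 - 1 = n - 1 + h * n := by
    have : n * (2 * h + 2) = 2 * (h * n + n) := by ring
    rw [this, Nat.mul_div_cancel_left _ two_pos]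
    omega
  rw [hbound]
  refine csSup_le' ?_
  rintro _ ⟨A, rfl⟩
  simpa using tensorRank_pairs_le
    ((finCongr (mul_comm 2 h)).trans finProdFinEquiv.symm) A (⟨0, hn⟩ : Fin n)
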